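/- Let S be a finite thick generalized quadrangle of order (s,t). Assume that for each point p a nontrivial group E(p) of symmetries with center p is given, that there is a prime r dividing |E(p)| for every point p, and set G = ⟨E(p) : p a point⟩. If B is a block of imprimitivity for the action of G on the point set (i.e., for every g ∈ G, either B^g = B or B^g ∩ B = ∅) with 1 < |B| < v, where v is the number of points, then B is an ovoid of S: its points are pairwise noncollinear and |B| = st + 1. -/

import Mathlib

open Equiv

section GQDefs

variable {P L : Type*}

/-- A generalized quadrangle of order `(s,t)`: every line has `s+1` points, every point is
on `t+1` lines, two distinct points are on at most one common line, and for every
non-incident point-line pair `(p, ℓ)` there is a unique pair `(q, M)` with `M` a line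
through `p` and `q` a point incident with both `M` and `ℓ`. -/
structure IsGQ (I : P → L → Prop) (s t : ℕ) : Prop where
  point_count : ∀ ℓ : L, Nat.card {p : P // I p ℓ} = s + 1
  line_count : ∀ p : P, Nat.card {ℓ : L // I p ℓ} = t + 1
  unique_line : ∀ ⦃p q : P⦄, p ≠ q → ∀ ⦃ℓ m : L⦄, I p ℓ → I q ℓ → I p m → I q m → ℓ = m
  quad : ∀ ⦃p : P⦄ ⦃ℓ : L⦄, ¬ I p ℓ →
    ∃! qM : P × L, I p qM.2 ∧ I qM.1 qM.2 ∧ I qM.1 ℓ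

/-- Two points are collinear if some line is incident with both. -/
def Coll (I : P → L → Prop) (x y : P) : Prop := ∃ ℓ : L, I x ℓ ∧ I y ℓ

/-- The automorphism group of an incidence structure, as a subgroup of
`Perm P × Perm L`: pairs of permutations preserving incidence. -/
def autGroup (I : P → L → Prop) : Subgroup (Perm P × Perm L) where
  carrier := {g | ∀ p ℓ, I (g.1 p) (g.2 ℓ) ↔ I p ℓ}
  one_mem' := fun _ _ => Iff.rfl
  mul_mem' := fun {a b} ha hb p ℓ => (ha (b.1 p) (b.2 ℓ)).trans (hb p ℓ)
  inv_mem' := by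
    intro a ha p ℓ
    have h := ha (a⁻¹.1 p) (a⁻¹.2 ℓ)
    simpa using h.symm

/-- The full group `Ẽ(p)` of symmetries with center `p`: automorphisms fixing every
point collinear with `p`. -/
def symmGroup (I : P → L → Prop) (p : P) : Subgroup (Perm P × Perm L) where
  carrier := {g | g ∈ autGroup I ∧ ∀ y : P, Coll I p y → g.1 y = y}
  one_mem' := ⟨(autGroup I).one_mem, fun _ _ => rfl⟩
  mul_mem' := by
    rintro a b ⟨ha, ha'⟩ ⟨hb, hb'⟩
    refine ⟨(autGroup I).mul_mem ha hb, fun y hy => ?_⟩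
    have : (a * b).1 y = a.1 (b.1 y) := rfl
    rw [this, hb' y hy, ha' y hy]
  inv_mem' := by
    rintro a ⟨ha, ha'⟩
    refine ⟨(autGroup I).inv_mem ha, fun y hy => ?_⟩
    have h : a⁻¹.1 (a.1 y) = y := by simp
    rw [ha' y hy] at h
    exact h

/-- `x^⊥`: the set of points collinear with `x` (including `x` itself). -/
def perpSet (I : P → L → Prop) (x : P) : Set P := {y | Coll I x y}

/-- The hyperbolic line `{x,y}^{⊥⊥}`: points collinear with every point of
`{x,y}^⊥ = x^⊥ ∩ y^⊥`. -/
def hypLine (I : P → L → Prop) (x y : P) : Set P :=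
  {z | ∀ w ∈ perpSet I x ∩ perpSet I y, Coll I z w}

/-- The group `G` generated by all the point-symmetries of the quadrangle. -/
def bigGroup (I : P → L → Prop) : Subgroup (Perm P × Perm L) :=
  ⨆ x : P, symmGroup I x

/-- The set `P_r` of `r`-points: points whose full group of symmetries has order
divisible by `r`. -/
def Pr (I : P → L → Prop) (r : ℕ) : Set P :=
  {y | r ∣ Nat.card (symmGroup I y)}

/-- The set `L_r` of lines incident with at least two points of `P_r`. -/
def Lr (I : P → L → Prop) (r : ℕ) : Set L :=
  {ℓ | ∃ x y : P, x ≠ y ∧ x ∈ Pr I r ∧ y ∈ Pr I r ∧ I x ℓ ∧ I y ℓ}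

/-- The stabilizer `G_u` of a point `u` in a group `G` of automorphisms. -/
def stabPt (G : Subgroup (Perm P × Perm L)) (u : P) : Subgroup (Perm P × Perm L) where
  carrier := {g | g ∈ G ∧ g.1 u = u}
  one_mem' := ⟨G.one_mem, rfl⟩
  mul_mem' := by
    rintro a b ⟨ha, ha'⟩ ⟨hb, hb'⟩
    refine ⟨G.mul_mem ha hb, ?_⟩
    have : (a * b).1 u = a.1 (b.1 u) := rfl
    rw [this, hb', ha']
  inv_mem' := by
    rintro a ⟨ha, ha'⟩
    refine ⟨G.inv_mem ha, ?_⟩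
    have h : a⁻¹.1 (a.1 u) = u := by simp
    rw [ha'] at h
    exact h

/-- The setwise stabilizer `G_ℓ` of a line `ℓ` in a group `G` of automorphisms. -/
def stabLine (G : Subgroup (Perm P × Perm L)) (ℓ : L) : Subgroup (Perm P × Perm L) where
  carrier := {g | g ∈ G ∧ g.2 ℓ = ℓ}
  one_mem' := ⟨G.one_mem, rfl⟩
  mul_mem' := by
    rintro a b ⟨ha, ha'⟩ ⟨hb, hb'⟩
    refine ⟨G.mul_mem ha hb, ?_⟩
    have : (a * b).2 ℓ = a.2 (b.2 ℓ) := rfl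
    rw [this, hb', ha']
  inv_mem' := by
    rintro a ⟨ha, ha'⟩
    refine ⟨G.inv_mem ha, ?_⟩
    have h : a⁻¹.2 (a.2 ℓ) = ℓ := by simp
    rw [ha'] at h
    exact h

/-- Isomorphism of incidence structures: a pair of bijections between the point sets and
the line sets preserving incidence in both directions. -/
def IsoTo {P L P' L' : Type*} (I : P → L → Prop) (I' : P' → L' → Prop) : Prop :=
  ∃ (e : P ≃ P') (f : L ≃ L'), ∀ p ℓ, I' (e p) (f ℓ) ↔ I p ℓ

end GQDefs

section ClassicalGQs

/-- The standard nondegenerate alternating bilinear form on `F^4`. -/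
def sympForm {F : Type*} [Field F] (x y : Fin 4 → F) : F :=
  x 0 * y 1 - x 1 * y 0 + x 2 * y 3 - x 3 * y 2

/-- Points of `W(3,q)`: the `1`-dimensional subspaces of `F_q^4`. -/
def W3Point (F : Type*) [Field F] : Type _ :=
  {W : Submodule F (Fin 4 → F) // Module.finrank F W = 1}

/-- Lines of `W(3,q)`: the `2`-dimensional totally isotropic subspaces of `F_q^4` with
respect to a nondegenerate alternating form. -/
def W3Line (F : Type*) [Field F] : Type _ :=
  {U : Submodule F (Fin 4 → F) //
    Module.finrank F U = 2 ∧ ∀ x ∈ U, ∀ y ∈ U, sympForm x y = 0}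

/-- Incidence in `W(3,q)` is given by inclusion. -/
def W3Incid (F : Type*) [Field F] : W3Point F → W3Line F → Prop :=
  fun W U => W.1 ≤ U.1

/-- The standard nondegenerate Hermitian sesquilinear form on `F_{q²}^4`, relative to the
field automorphism `x ↦ x^q`. -/
def hermForm3 {F : Type*} [Field F] (q : ℕ) (x y : Fin 4 → F) : F :=
  x 0 * y 1 ^ q + x 1 * y 0 ^ q + x 2 * y 3 ^ q + x 3 * y 2 ^ q

/-- The standard nondegenerate Hermitian sesquilinear form on `F_{q²}^5`, relative to the
field automorphism `x ↦ x^q`. -/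
def hermForm4 {F : Type*} [Field F] (q : ℕ) (x y : Fin 5 → F) : F :=
  x 0 * y 1 ^ q + x 1 * y 0 ^ q + x 2 * y 3 ^ q + x 3 * y 2 ^ q + x 4 * y 4 ^ q

/-- Points of `H(3,q²)`: the `1`-dimensional isotropic subspaces of `F_{q²}^4`. -/
def H3Point (F : Type*) [Field F] (q : ℕ) : Type _ :=
  {W : Submodule F (Fin 4 → F) //
    Module.finrank F W = 1 ∧ ∀ x ∈ W, hermForm3 q x x = 0}

/-- Lines of `H(3,q²)`: the `2`-dimensional totally isotropic subspaces of `F_{q²}^4`. -/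
def H3Line (F : Type*) [Field F] (q : ℕ) : Type _ :=
  {U : Submodule F (Fin 4 → F) //
    Module.finrank F U = 2 ∧ ∀ x ∈ U, ∀ y ∈ U, hermForm3 q x y = 0}

/-- Incidence in `H(3,q²)` is given by inclusion. -/
def H3Incid (F : Type*) [Field F] (q : ℕ) : H3Point F q → H3Line F q → Prop :=
  fun W U => W.1 ≤ U.1

/-- Points of `H(4,q²)`: the `1`-dimensional isotropic subspaces of `F_{q²}^5`. -/
def H4Point (F : Type*) [Field F] (q : ℕ) : Type _ :=
  {W : Submodule F (Fin 5 → F) //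
    Module.finrank F W = 1 ∧ ∀ x ∈ W, hermForm4 q x x = 0}

/-- Lines of `H(4,q²)`: the `2`-dimensional totally isotropic subspaces of `F_{q²}^5`. -/
def H4Line (F : Type*) [Field F] (q : ℕ) : Type _ :=
  {U : Submodule F (Fin 5 → F) //
    Module.finrank F U = 2 ∧ ∀ x ∈ U, ∀ y ∈ U, hermForm4 q x y = 0}

/-- Incidence in `H(4,q²)` is given by inclusion. -/
def H4Incid (F : Type*) [Field F] (q : ℕ) : H4Point F q → H4Line F q → Prop :=
  fun W U => W.1 ≤ U.1

end ClassicalGQs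

namespace IsGQ

variable {P L : Type*} {I : P → L → Prop} {s t : ℕ}

theorem coll_symm {x y : P} (h : Coll I x y) : Coll I y x :=
  let ⟨ℓ, hx, hy⟩ := h
  ⟨ℓ, hy, hx⟩

/-- Every line has a point different from two given ones. -/
theorem exists_point_ne [Finite P] (h : IsGQ I s t) (hs : 2 ≤ s) (ℓ : L) (a b : P) :
    ∃ c, I c ℓ ∧ c ≠ a ∧ c ≠ b := by
  have hcard : {p : P | I p ℓ}.ncard = s + 1 := h.point_count ℓ
  have hpair : ({a, b} : Set P).ncard ≤ 2 := by
    simpa using Set.ncard_insert_le a {b}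
  obtain ⟨c, hc, hcab⟩ := Set.exists_mem_notMem_of_ncard_lt_ncard
    (s := {a, b}) (t := {p : P | I p ℓ}) (by omega)
  simp only [Set.mem_insert_iff, Set.mem_singleton_iff, not_or] at hcab
  exact ⟨c, hc, hcab⟩

/-- Every point is on a line different from a given one. -/
theorem exists_line_ne [Finite L] (h : IsGQ I s t) (ht : 2 ≤ t) (p : P) (ℓ : L) :
    ∃ m, I p m ∧ m ≠ ℓ := by
  have hcard : {m : L | I p m}.ncard = t + 1 := h.line_count p
  obtain ⟨m, hm, hne⟩ := Set.exists_ne_of_one_lt_ncard (s := {m : L | I p m}) (by omega) ℓ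
  exact ⟨m, hm, hne⟩

theorem exists_line [Finite L] (h : IsGQ I s t) (p : P) : ∃ m, I p m := by
  have hcard : {m : L | I p m}.ncard = t + 1 := h.line_count p
  exact Set.nonempty_of_ncard_ne_zero (s := {m : L | I p m}) (by omega)

theorem coll_refl [Finite L] (h : IsGQ I s t) (p : P) : Coll I p p :=
  let ⟨m, hm⟩ := h.exists_line p
  ⟨m, hm, hm⟩

theorem exists_proj (h : IsGQ I s t) {p : P} {ℓ : L} (hp : ¬ I p ℓ) :
    ∃ q, I q ℓ ∧ Coll I p q := by
  obtain ⟨⟨q, M⟩, ⟨h1, h2, h3⟩, -⟩ := h.quad hp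
  exact ⟨q, h3, M, h1, h2⟩

/-- There are no triangles. -/
theorem proj_unique (h : IsGQ I s t) {p q q' : P} {ℓ : L} (hp : ¬ I p ℓ) (hq : I q ℓ)
    (hq' : I q' ℓ) (hc : Coll I p q) (hc' : Coll I p q') : q = q' := by
  obtain ⟨M, h1, h2⟩ := hc
  obtain ⟨M', h1', h2'⟩ := hc'
  have := (h.quad hp).unique (y₁ := (q, M)) (y₂ := (q', M')) ⟨h1, h2, hq⟩ ⟨h1', h2', hq'⟩
  exact congrArg Prod.fst this

theorem coll_apply {g : Equiv.Perm P × Equiv.Perm L} (hg : g ∈ autGroup I) {x y : P}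
    (hxy : Coll I x y) : Coll I (g.1 x) (g.1 y) := by
  obtain ⟨ℓ, hx, hy⟩ := hxy
  exact ⟨g.2 ℓ, (hg x ℓ).2 hx, (hg y ℓ).2 hy⟩

/-- Collinear points that are both collinear with every point of `{x,z}^⊥`, for noncollinear
`x` and `z`, coincide. -/
theorem eq_of_coll_of_perp [Finite L] (h : IsGQ I s t) (ht : 2 ≤ t) {x z a b : P}
    (hxz : ¬ Coll I x z) (ha : ∀ w, Coll I x w → Coll I z w → Coll I a w)
    (hb : ∀ w, Coll I x w → Coll I z w → Coll I b w) (hab : Coll I a b) : a = b := by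
  by_contra hne
  obtain ⟨ℓ, haℓ, hbℓ⟩ := hab
  have hmem : ∀ w, Coll I x w → Coll I z w → I w ℓ := fun w h1 h2 => by
    by_contra hw
    exact hne (h.proj_unique hw haℓ hbℓ (coll_symm (ha w h1 h2)) (coll_symm (hb w h1 h2)))
  obtain ⟨m₁, hm₁⟩ := h.exists_line x
  obtain ⟨m₂, hm₂, hm⟩ := h.exists_line_ne ht x m₁
  obtain ⟨w₁, hw₁, hz₁⟩ := h.exists_proj (p := z) (ℓ := m₁) fun hz => hxz ⟨_, hm₁, hz⟩
  obtain ⟨w₂, hw₂, hz₂⟩ := h.exists_proj (p := z) (ℓ := m₂) fun hz => hxz ⟨_, hm₂, hz⟩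
  have hx₁ : Coll I x w₁ := ⟨_, hm₁, hw₁⟩
  have hx₂ : Coll I x w₂ := ⟨_, hm₂, hw₂⟩
  have hw : w₁ = w₂ := by
    by_cases hxℓ : I x ℓ
    · exact h.proj_unique (fun hz => hxz ⟨_, hxℓ, hz⟩) (hmem _ hx₁ hz₁) (hmem _ hx₂ hz₂) hz₁ hz₂
    · exact h.proj_unique hxℓ (hmem _ hx₁ hz₁) (hmem _ hx₂ hz₂) hx₁ hx₂
  subst hw
  refine hm (h.unique_line (p := x) (q := w₁) ?_ hm₂ hw₂ hm₁ hw₁)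
  rintro rfl
  exact hxz (coll_symm hz₁)

/-- A symmetry with center `p` fixing a point `y` not collinear with `p` fixes every point
collinear with `y`. -/
theorem symm_fixes_perp [Finite L] (h : IsGQ I s t) (ht : 2 ≤ t)
    {p y z : P} {g : Equiv.Perm P × Equiv.Perm L} (hg : g ∈ symmGroup I p)
    (hpy : ¬ Coll I p y) (hy : g.1 y = y) (hyz : Coll I y z) : g.1 z = z := by
  by_cases hpz : Coll I p z
  · exact hg.2 z hpz
  obtain ⟨M, hyM, hzM⟩ := hyz
  have hpM : ¬ I p M := fun hp => hpy ⟨M, hp, hyM⟩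
  obtain ⟨w, hwM, K, hpK, hwK⟩ := h.exists_proj hpM
  obtain ⟨N, hpN, hN⟩ := h.exists_line_ne ht p K
  obtain ⟨n, hnN, hzn⟩ := h.exists_proj (p := z) (ℓ := N) fun hz => hpz ⟨_, hpN, hz⟩
  have hnM : ¬ I n M := fun hn => by
    have hnw : n = w := h.proj_unique hpM hn hwM ⟨N, hpN, hnN⟩ ⟨K, hpK, hwK⟩
    subst hnw
    exact hN (h.unique_line (fun hpn : p = n => hpM (hpn ▸ hwM)) hpN hnN hpK hwK)
  have hgw : g.1 w = w := hg.2 w ⟨K, hpK, hwK⟩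
  have hgn : g.1 n = n := hg.2 n ⟨N, hpN, hnN⟩
  have hgM : g.2 M = M := by
    refine h.unique_line (p := y) (q := w) ?_ ?_ ?_ hyM hwM
    · rintro rfl
      exact hpy ⟨K, hpK, hwK⟩
    · simpa [hy] using (hg.1 y M).2 hyM
    · simpa [hgw] using (hg.1 w M).2 hwM
  have hgz : I (g.1 z) M := by simpa [hgM] using (hg.1 z M).2 hzM
  have hgzn : Coll I (g.1 z) n := by simpa [hgn] using coll_apply hg.1 hzn
  exact h.proj_unique hnM hgz hzM (coll_symm hgzn) (coll_symm hzn)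

/-- A symmetry with center `p` fixing a point not collinear with `p` fixes every point. -/
theorem symm_fixes_all [Finite P] [Finite L] (h : IsGQ I s t) (hs : 2 ≤ s) (ht : 2 ≤ t)
    {p y : P} {g : Equiv.Perm P × Equiv.Perm L} (hg : g ∈ symmGroup I p)
    (hpy : ¬ Coll I p y) (hy : g.1 y = y) (z : P) : g.1 z = z := by
  by_contra hz
  have hpz : ¬ Coll I p z := fun hc => hz (hg.2 z hc)
  have hz_perp : ∀ y, ¬ Coll I p y → g.1 y = y → ¬ Coll I z y := fun y hpy hy hc =>
    hz (h.symm_fixes_perp ht hg hpy hy (coll_symm hc))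
  have hperp : ∀ y v, ¬ Coll I p y → g.1 y = y → Coll I y v → Coll I z v → Coll I p v := by
    intro y v hpy hy hyv hzv
    by_contra hpv
    exact hz_perp v hpv (h.symm_fixes_perp ht hg hpy hy hyv) hzv
  obtain ⟨K, hzK⟩ := h.exists_line z
  obtain ⟨K', hzK', hKK'⟩ := h.exists_line_ne ht z K
  obtain ⟨v, hvK, hyv⟩ := h.exists_proj (p := y) (ℓ := K)
    fun hc => hz_perp y hpy hy ⟨_, hzK, hc⟩
  have hpv := hperp y v hpy hy hyv ⟨_, hzK, hvK⟩
  have hyv' := hyv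
  obtain ⟨M, hyM, hvM⟩ := hyv'
  have hpM : ¬ I p M := fun hp => hpy ⟨M, hp, hyM⟩
  obtain ⟨y', hy'M, hy'y, hy'v⟩ := h.exists_point_ne hs M y v
  have hpy' : ¬ Coll I p y' := fun hc => hy'v (h.proj_unique hpM hy'M hvM hc hpv)
  have hy' : g.1 y' = y' := h.symm_fixes_perp ht hg hpy hy ⟨M, hyM, hy'M⟩
  obtain ⟨v₁, hv₁, hyv₁⟩ := h.exists_proj (p := y) (ℓ := K')
    fun hc => hz_perp y hpy hy ⟨_, hzK', hc⟩
  obtain ⟨v₂, hv₂, hyv₂⟩ := h.exists_proj (p := y') (ℓ := K')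
    fun hc => hz_perp y' hpy' hy' ⟨_, hzK', hc⟩
  have hpv₁ := hperp y v₁ hpy hy hyv₁ ⟨_, hzK', hv₁⟩
  have hpv₂ := hperp y' v₂ hpy' hy' hyv₂ ⟨_, hzK', hv₂⟩
  have h12 : v₁ = v₂ :=
    h.proj_unique (fun hp => hpz ⟨K', hp, hzK'⟩) hv₁ hv₂ hpv₁ hpv₂
  subst h12
  by_cases hv₁M : I v₁ M
  · have : v₁ = v := h.proj_unique hpM hv₁M hvM hpv₁ hpv
    subst this
    exact hKK' (h.unique_line (fun hzv : z = v₁ => hpz (hzv ▸ hpv)) hzK' hv₁ hzK hvK)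
  · exact hy'y (h.proj_unique hv₁M hy'M hyM (coll_symm hyv₂) (coll_symm hyv₁))

/-- A symmetry with center `p` fixing a point not collinear with `p` is trivial. -/
theorem symm_eq_one [Finite P] [Finite L] (h : IsGQ I s t) (hs : 2 ≤ s) (ht : 2 ≤ t)
    {p y : P} {g : Equiv.Perm P × Equiv.Perm L} (hg : g ∈ symmGroup I p)
    (hpy : ¬ Coll I p y) (hy : g.1 y = y) : g = 1 := by
  have hfix := h.symm_fixes_all hs ht hg hpy hy
  refine Prod.ext (Equiv.ext hfix) (Equiv.ext fun ℓ => ?_)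
  obtain ⟨a, ha, -, -⟩ := h.exists_point_ne hs ℓ p p
  obtain ⟨b, hb, hba, -⟩ := h.exists_point_ne hs ℓ a a
  refine h.unique_line hba ?_ ?_ hb ha
  · simpa [hfix] using (hg.1 b ℓ).2 hb
  · simpa [hfix] using (hg.1 a ℓ).2 ha

/-- A set of points containing `z` whenever it contains a point collinear with `z` and a point
not collinear with `z` has at most one point or is everything. -/
theorem eq_univ_of_closed [Finite P] [Finite L] (h : IsGQ I s t) (hs : 2 ≤ s) (ht : 2 ≤ t)
    {B : Set P} (hB : ∀ x ∈ B, ∀ b ∈ B, ∀ z, Coll I z b → ¬ Coll I z x → z ∈ B)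
    (hnt : B.Nontrivial) : B = Set.univ := by
  have hperp : ∀ x ∈ B, ∀ y ∈ B, x ≠ y → Coll I x y → ∀ z, Coll I x z → z ∈ B := by
    rintro x hx y hy hne ⟨ℓ, hxℓ, hyℓ⟩ z hxz
    have hoff : ∀ z, Coll I x z → ¬ I z ℓ → z ∈ B := fun z hxz hz =>
      hB y hy x hx z (coll_symm hxz) fun hzy =>
        hne (h.proj_unique hz hxℓ hyℓ (coll_symm hxz) hzy)
    by_cases hz : I z ℓ
    · obtain ⟨m, hxm, hm⟩ := h.exists_line_ne ht x ℓ
      obtain ⟨u, hum, hux, -⟩ := h.exists_point_ne hs m x x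
      have huℓ : ¬ I u ℓ := fun hu => hm (h.unique_line hux hum hxm hu hxℓ)
      by_cases hzx : z = x
      · exact hzx ▸ hx
      · exact hB u (hoff u ⟨m, hxm, hum⟩ huℓ) x hx z (coll_symm hxz) fun hzu =>
          hzx (h.proj_unique huℓ hz hxℓ (coll_symm hzu) ⟨m, hum, hxm⟩)
    · exact hoff z hxz hz
  obtain ⟨x, hx, y, hy, hne, hxy⟩ : ∃ x ∈ B, ∃ y ∈ B, x ≠ y ∧ Coll I x y := by
    obtain ⟨x, hx, y, hy, hne⟩ := hnt
    by_cases hxy : Coll I x y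
    · exact ⟨x, hx, y, hy, hne, hxy⟩
    obtain ⟨m, hxm⟩ := h.exists_line x
    have hym : ¬ I y m := fun hym => hxy ⟨m, hxm, hym⟩
    obtain ⟨q, hqm, hyq⟩ := h.exists_proj hym
    obtain ⟨z, hzm, hzx, hzq⟩ := h.exists_point_ne hs m x q
    exact ⟨x, hx, z, hB y hy x hx z ⟨m, hzm, hxm⟩
      fun hzy => hzq (h.proj_unique hym hzm hqm (coll_symm hzy) hyq), hzx.symm, m, hxm, hzm⟩
  refine Set.eq_univ_of_forall fun z => ?_
  by_cases hxz : Coll I x z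
  · exact hperp x hx y hy hne hxy z hxz
  obtain ⟨m, hxm⟩ := h.exists_line x
  obtain ⟨q, hqm, hzq⟩ := h.exists_proj (p := z) (ℓ := m) fun hz => hxz ⟨m, hxm, hz⟩
  have hqx : q ≠ x := by
    rintro rfl
    exact hxz (coll_symm hzq)
  exact hperp q (hperp x hx y hy hne hxy q ⟨m, hxm, hqm⟩) x hx hqx ⟨m, hqm, hxm⟩ z
    (coll_symm hzq)

end IsGQ

theorem ncard_modEq_ncard_fixed {α : Type*} [Finite α] {r : ℕ} (hr : r.Prime)
    (f : Equiv.Perm α) (hf : f ^ r = 1) (C : Set α) (hC : Set.MapsTo f C C) :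
    C.ncard ≡ {c ∈ C | f c = c}.ncard [MOD r] := by
  classical
  have := Fintype.ofFinite α
  have : Fact r.Prime := ⟨hr⟩
  let φ : Function.End C := hC.restrict f C C
  have hφ : φ ^ r ^ 1 = 1 := by
    have hiter : ∀ n (c : C), ((φ ^ n) c : α) = (f ^ n) c := by
      intro n
      induction n with
      | zero => intro c; rfl
      | succ n ih =>
        intro c
        rw [pow_succ, pow_succ]
        exact ih (φ c)
    funext c
    apply Subtype.ext
    rw [hiter, pow_one, hf]
    rfl
  have key := Equiv.Perm.card_fixedPoints_modEq hφ
  rw [← Nat.card_eq_fintype_card, ← Nat.card_eq_fintype_card, Nat.card_coe_set_eq] at key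
  refine key.trans (congrArg (· % r) ?_)
  rw [Nat.card_coe_set_eq, ← Set.ncard_image_of_injective _ Subtype.val_injective]
  congr 1
  ext c
  constructor
  · rintro ⟨c, hc, rfl⟩
    exact ⟨c.2, congrArg Subtype.val hc⟩
  · rintro ⟨hc, hfc⟩
    exact ⟨⟨c, hc⟩, Subtype.ext hfc, rfl⟩

/-- A block containing a point collinear with `z` and a point not collinear with `z`
contains `z`. -/
theorem IsGQ.mem_block {P L : Type*} [Finite P] [Finite L]
    {I : P → L → Prop} {s t : ℕ} (h : IsGQ I s t) (hs : 2 ≤ s) (ht : 2 ≤ t)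
    {E : P → Subgroup (Equiv.Perm P × Equiv.Perm L)}
    (hEsym : ∀ p : P, E p ≤ symmGroup I p)
    {r : ℕ} (hr : r.Prime) (hdiv : ∀ p : P, r ∣ Nat.card (E p))
    {B : Set P}
    (hblock : ∀ g ∈ (⨆ p : P, E p : Subgroup (Equiv.Perm P × Equiv.Perm L)),
      ⇑g.1 '' B = B ∨ Disjoint (⇑g.1 '' B) B)
    {x b z : P} (hx : x ∈ B) (hb : b ∈ B) (hzb : Coll I z b) (hzx : ¬ Coll I z x) :
    z ∈ B := by
  have : Fact r.Prime := ⟨hr⟩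
  by_contra hz
  have hxz : ¬ Coll I x z := fun hc => hzx (IsGQ.coll_symm hc)
  let C : Set P := {c ∈ B | ∀ w, Coll I x w → Coll I z w → Coll I c w}
  have hcount : ∀ u, (∃ b ∈ B, Coll I u b) → (∀ w, Coll I x w → Coll I z w → Coll I u w) →
      C.ncard ≡ (C ∩ {u}).ncard [MOD r] := by
    rintro u ⟨b, hb, hub⟩ hu
    obtain ⟨⟨g, hgE⟩, hord⟩ := exists_prime_orderOf_dvd_card' r (hdiv u)
    rw [Subgroup.orderOf_mk] at hord
    have hg := hEsym u hgE
    have hgB : ⇑g.1 '' B = B := (hblock g (Subgroup.mem_iSup_of_mem u hgE)).resolve_right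
      (Set.not_disjoint_iff.2 ⟨b, ⟨b, hb, hg.2 b hub⟩, hb⟩)
    have hpow : g.1 ^ r = 1 := congrArg Prod.fst (hord ▸ pow_orderOf_eq_one g : g ^ r = 1)
    have hmaps : Set.MapsTo g.1 C C := fun c hc =>
      ⟨hgB ▸ Set.mem_image_of_mem _ hc.1, fun w hxw hzw => by
        simpa [hg.2 w (hu w hxw hzw)] using IsGQ.coll_apply hg.1 (hc.2 w hxw hzw)⟩
    refine (ncard_modEq_ncard_fixed hr g.1 hpow C hmaps).trans (congrArg (· % r) ?_)
    congr 1
    ext c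
    refine and_congr_right fun hc => ⟨fun hgc => ?_, ?_⟩
    · by_contra hne
      have huc : ¬ Coll I u c := fun huc => hne (h.eq_of_coll_of_perp ht hxz hu hc.2 huc).symm
      rw [h.symm_eq_one hs ht hg huc hgc, orderOf_one] at hord
      exact hr.one_lt.ne hord
    · rintro rfl
      exact hg.2 _ (h.coll_refl _)
  have hxC : x ∈ C := ⟨hx, fun _ hw _ => hw⟩
  have h1 := hcount x ⟨x, hx, h.coll_refl x⟩ fun _ hw _ => hw
  have h0 := hcount z ⟨b, hb, hzb⟩ fun _ _ hw => hw
  rw [Set.inter_eq_right.2 (Set.singleton_subset_iff.2 hxC), Set.ncard_singleton] at h1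
  rw [Set.inter_singleton_eq_empty.2 fun hzC => hz hzC.1, Set.ncard_empty] at h0
  exact hr.one_lt.ne' (Nat.dvd_one.1 ((Nat.modEq_zero_iff_dvd).1 (h1.symm.trans h0)))

/-- A nontrivial block of imprimitivity `B` for the action on points of the group `G`
generated by nontrivial symmetry groups `E(p)` (all of order divisible by the prime `r`)
is an ovoid: its points are pairwise noncollinear and `|B| = st + 1`. -/
theorem block_is_ovoid {P L : Type} [Finite P] [Finite L]
    (I : P → L → Prop) (s t : ℕ) (hGQ : IsGQ I s t) (hs : 2 ≤ s) (ht : 2 ≤ t)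
    (E : P → Subgroup (Equiv.Perm P × Equiv.Perm L))
    (hEsym : ∀ p : P, E p ≤ symmGroup I p) (hEnt : ∀ p : P, E p ≠ ⊥)
    (r : ℕ) (hr : r.Prime) (hdiv : ∀ p : P, r ∣ Nat.card (E p))
    (B : Set P)
    (hblock : ∀ g ∈ (⨆ p : P, E p : Subgroup (Equiv.Perm P × Equiv.Perm L)),
      ⇑g.1 '' B = B ∨ Disjoint (⇑g.1 '' B) B)
    (hB1 : 1 < B.ncard) (hB2 : B.ncard < Nat.card P) :
    (∀ x ∈ B, ∀ y ∈ B, x ≠ y → ¬ Coll I x y) ∧ B.ncard = s * t + 1 := by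
  -- The hypotheses are contradictory: the group generated by the `E p` is primitive on points.
  have hB : B = Set.univ := hGQ.eq_univ_of_closed hs ht
    (fun x hx b hb z hzb hzx => hGQ.mem_block hs ht hEsym hr hdiv hblock hx hb hzb hzx)
    (Set.one_lt_ncard_iff_nontrivial.1 hB1)
  rw [hB, Set.ncard_univ] at hB2
  exact absurd hB2 (lt_irrefl _)
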